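/- Let λ > 1, r > 0, η ∈ [γ/λ, 1] and η̄ ∈ [γ/λ, 1] with γ > 1 and η̄ ≥ η. Then the function δ(τ) = (1 + r + τ(r·η·λ + 1)) / ((η·λ - 1) + τ·η·λ·(η̄·λ - 1)) is strictly decreasing in τ on [0, ∞), provided η·λ > 1 and η̄·λ > 1. -/

import Mathlib

/-- A fractional linear function with denominator positive on `[0, ∞)` and negative determinant is
strictly decreasing there. -/
theorem strictAntiOn_linear_div_linear {p q c d : ℝ} (hc : 0 < c) (hd : 0 ≤ d)
    (h : q * c < p * d) :
    StrictAntiOn (fun τ : ℝ => (p + τ * q) / (c + τ * d)) (Set.Ici 0) := by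
  intro x (hx : 0 ≤ x) y (hy : 0 ≤ y) hxy
  have hDx : 0 < c + x * d := by positivity
  have hDy : 0 < c + y * d := by positivity
  change (p + y * q) / (c + y * d) < (p + x * q) / (c + x * d)
  rw [div_lt_div_iff₀ hDy hDx]
  linarith [mul_pos (sub_pos.2 hxy) (sub_pos.2 h)]

theorem stmt_0 (γ lam r η ηb : ℝ) (hγ : 1 < γ) (hlam : 1 < lam) (hr : 0 < r)
    (hη : η ∈ Set.Icc (γ / lam) 1) (hηb : ηb ∈ Set.Icc (γ / lam) 1)
    (hle : η ≤ ηb) (h1 : 1 < η * lam) (h2 : 1 < ηb * lam) :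
    StrictAntiOn
      (fun τ : ℝ =>
        (1 + r + τ * (r * η * lam + 1)) / ((η * lam - 1) + τ * η * lam * (ηb * lam - 1)))
      (Set.Ici (0 : ℝ)) := by
  have hab : η * lam ≤ ηb * lam := by gcongr
  have hdet : (r * (η * lam) + 1) * (η * lam - 1)
      < (1 + r) * (η * lam * (ηb * lam - 1)) := by
    generalize η * lam = a at *
    generalize ηb * lam = b at *
    calc (r * a + 1) * (a - 1) < ((1 + r) * a) * (a - 1) :=
          mul_lt_mul_of_pos_right (by linarith) (by linarith)
      _ ≤ ((1 + r) * a) * (b - 1) :=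
          mul_le_mul_of_nonneg_left (by linarith) (by positivity)
      _ = (1 + r) * (a * (b - 1)) := by ring
  have hd : 0 ≤ η * lam * (ηb * lam - 1) := mul_nonneg (by linarith) (by linarith)
  simpa only [mul_assoc] using strictAntiOn_linear_div_linear (sub_pos.2 h1) hd hdet
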